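/- arXiv:2103.13016 — 15 statements merged into one kernel-verified Lean document; each statement's English description precedes it below -/
import Mathlib

section
/- Let a, b, η, τ be real numbers with 0 < a < b, η > 0, τ > 0. If ω > 0 is such that λ = iω is a root of the characteristic equation λ + ηa + ηb e^(−λτ) = 0, then ηa + ηb cos(ωτ) = 0, ω = ηb sin(ωτ), and there exists a natural number n such that 2nπ + π/2 < ωτ < 2nπ + π. -/
open Real

/-- If `λ = iω` (with `ω > 0`) is a root of the characteristic equation
`λ + ηa + ηb e^{−λτ} = 0` with `0 < a < b`, `η > 0`, `τ > 0`, then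
`ηa + ηb cos(ωτ) = 0`, `ω = ηb sin(ωτ)`, and `2nπ + π/2 < ωτ < 2nπ + π`
for some natural number `n`. -/
theorem bd_char_imaginary_root (a b η τ ω : ℝ)
    (ha : 0 < a) (hab : a < b) (hη : 0 < η) (hτ : 0 < τ) (hω : 0 < ω)
    (hroot : (Complex.I * ω) + (η : ℂ) * a + (η : ℂ) * b *
      Complex.exp (-(Complex.I * ω) * τ) = 0) :
    η * a + η * b * Real.cos (ω * τ) = 0 ∧
    ω = η * b * Real.sin (ω * τ) ∧
    ∃ n : ℕ, 2 * (n : ℝ) * π + π / 2 < ω * τ ∧ ω * τ < 2 * (n : ℝ) * π + π := by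
  have e : Complex.exp (-(Complex.I * ω) * τ)
      = ((Real.cos (ω * τ) : ℝ) : ℂ) - ((Real.sin (ω * τ) : ℝ) : ℂ) * Complex.I := by
    have h : -(Complex.I * ω) * τ = ((-(ω * τ) : ℝ) : ℂ) * Complex.I := by
      push_cast; ring
    rw [h, Complex.exp_mul_I, ← Complex.ofReal_cos, ← Complex.ofReal_sin,
      Real.cos_neg, Real.sin_neg]
    push_cast; ring
  rw [e] at hroot
  have h0 : ((η * a + η * b * Real.cos (ω * τ) : ℝ) : ℂ)
      + ((ω - η * b * Real.sin (ω * τ) : ℝ) : ℂ) * Complex.I = 0 := by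
    rw [← hroot]; push_cast; ring
  have hre : η * a + η * b * Real.cos (ω * τ) = 0 := by
    have := congrArg Complex.re h0
    simpa only [Complex.add_re, Complex.add_im, Complex.re_ofReal_mul, Complex.im_ofReal_mul, Complex.ofReal_re, Complex.ofReal_im, Complex.I_re, Complex.I_im, mul_zero, mul_one, add_zero, zero_add, Complex.zero_re, Complex.zero_im] using this
  have him : ω - η * b * Real.sin (ω * τ) = 0 := by
    have := congrArg Complex.im h0
    simpa only [Complex.add_re, Complex.add_im, Complex.re_ofReal_mul, Complex.im_ofReal_mul, Complex.ofReal_re, Complex.ofReal_im, Complex.I_re, Complex.I_im, mul_zero, mul_one, add_zero, zero_add, Complex.zero_re, Complex.zero_im] using this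
  have hb : 0 < η * b := mul_pos hη (ha.trans hab)
  have hs : 0 < Real.sin (ω * τ) := by
    by_contra h
    nlinarith [mul_nonneg hb.le (neg_nonneg.2 (not_lt.1 h))]
  have hc : Real.cos (ω * τ) < 0 := by
    by_contra h
    nlinarith [mul_nonneg hb.le (not_lt.1 h), mul_pos hη ha]
  refine ⟨hre, by linarith, ⌊ω * τ / (2 * π)⌋₊, ?_⟩
  have hp := Real.pi_pos
  have h2p : 0 < 2 * π := by linarith
  have l1 := Nat.floor_le (a := ω * τ / (2 * π)) (by positivity)
  have l2 := Nat.lt_floor_add_one (ω * τ / (2 * π))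
  rw [le_div_iff₀ h2p] at l1
  rw [div_lt_iff₀ h2p] at l2
  generalize ⌊ω * τ / (2 * π)⌋₊ = n at *
  rw [← Real.sin_sub_nat_mul_two_pi _ n] at hs
  rw [← Real.cos_sub_nat_mul_two_pi _ n] at hc
  have hlt : ω * τ - n * (2 * π) < π := by
    by_contra h
    have := Real.sin_nonneg_of_nonneg_of_le_pi
      (x := ω * τ - n * (2 * π) - π) (by linarith) (by linarith)
    rw [Real.sin_sub_pi] at this
    linarith
  have hgt : π / 2 < ω * τ - n * (2 * π) := by
    by_contra h
    have := Real.cos_nonneg_of_neg_pi_div_two_le_of_le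
      (x := ω * τ - n * (2 * π)) (by linarith) (by linarith)
    linarith
  constructor <;> linarith
end

section
/- Let a, b, η, τ be real numbers with 0 ≤ a < b, η > 0, τ > 0. If ω > 0 is such that λ = iω is a root of the characteristic equation λ + ηa + ηb e^(−λτ) = 0, then ω = η√(b² − a²). -/
open Real

/-- If `λ = iω` (with `ω > 0`) is a root of the characteristic equation
`λ + ηa + ηb e^{−λτ} = 0` with `0 ≤ a < b`, `η > 0`, `τ > 0`, then
`ω = η √(b² − a²)`. -/
theorem bd_char_imaginary_root_freq (a b η τ ω : ℝ)
    (ha : 0 ≤ a) (hab : a < b) (hη : 0 < η) (hτ : 0 < τ) (hω : 0 < ω)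
    (hroot : (Complex.I * ω) + (η : ℂ) * a + (η : ℂ) * b *
      Complex.exp (-(Complex.I * ω) * τ) = 0) :
    ω = η * Real.sqrt (b ^ 2 - a ^ 2) := by
  have hre := congrArg Complex.re hroot
  have him := congrArg Complex.im hroot
  simp [Complex.exp_re, Complex.exp_im] at hre him
  have hsc := Real.sin_sq_add_cos_sq (ω * τ)
  have key : ω ^ 2 = η ^ 2 * (b ^ 2 - a ^ 2) := by
    have h1 : η * b * Real.cos (ω * τ) = -(η * a) := by linarith
    have h2 : η * b * Real.sin (ω * τ) = ω := by linarith
    have h3 : (η * b * Real.sin (ω * τ)) ^ 2 + (η * b * Real.cos (ω * τ)) ^ 2 = (η * b) ^ 2 := by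
      linear_combination (η * b) ^ 2 * hsc
    rw [h1, h2] at h3
    linarith
  rw [← Real.sqrt_sq hω.le, key, Real.sqrt_mul (sq_nonneg η), Real.sqrt_sq hη.le]
end

section
/- Let a, b, η, τ be real numbers with 0 ≤ a < b, η > 0, τ > 0, and let ω > 0 satisfy ωτ ≤ π. Then λ = iω is a root of the characteristic equation λ + ηa + ηb e^(−λτ) = 0 if and only if ω = η√(b² − a²) and ητ√(b² − a²) = arccos(−a/b). -/
open Real

/-- For `0 ≤ a < b`, `η > 0`, `τ > 0`, and `ω > 0` with `ωτ ≤ π`,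
`λ = iω` is a root of the characteristic equation `λ + ηa + ηb e^{−λτ} = 0`
if and only if `ω = η √(b² − a²)` and `ητ √(b² − a²) = arccos(−a/b)`. -/
theorem bd_char_hopf_condition (a b η τ ω : ℝ)
    (ha : 0 ≤ a) (hab : a < b) (hη : 0 < η) (hτ : 0 < τ) (hω : 0 < ω)
    (hωτ : ω * τ ≤ π) :
    ((Complex.I * ω) + (η : ℂ) * a + (η : ℂ) * b *
        Complex.exp (-(Complex.I * ω) * τ) = 0) ↔
      (ω = η * Real.sqrt (b ^ 2 - a ^ 2) ∧
        η * τ * Real.sqrt (b ^ 2 - a ^ 2) = Real.arccos (-a / b)) := by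
  have hb : 0 < b := lt_of_le_of_lt ha hab
  have hexp : Complex.exp (-(Complex.I * ω) * τ)
      = (Real.cos (ω * τ) : ℂ) - (Real.sin (ω * τ) : ℂ) * Complex.I := by
    have h1 : -(Complex.I * ω) * τ = ((-(ω * τ) : ℝ) : ℂ) * Complex.I := by
      push_cast; ring
    rw [h1, Complex.exp_mul_I, ← Complex.ofReal_cos, ← Complex.ofReal_sin,
      Real.cos_neg, Real.sin_neg]
    push_cast; ring
  have hsplit : ((Complex.I * ω) + (η : ℂ) * a + (η : ℂ) * b *
        Complex.exp (-(Complex.I * ω) * τ) = 0) ↔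
      (η * a + η * b * Real.cos (ω * τ) = 0 ∧ ω - η * b * Real.sin (ω * τ) = 0) := by
    have h2 : (Complex.I * ω) + (η : ℂ) * a + (η : ℂ) * b *
        Complex.exp (-(Complex.I * ω) * τ)
        = ((η * a + η * b * Real.cos (ω * τ) : ℝ) : ℂ)
          + ((ω - η * b * Real.sin (ω * τ) : ℝ) : ℂ) * Complex.I := by
      rw [hexp]; push_cast; ring
    rw [h2, Complex.ext_iff]
    simp only [Complex.add_re, Complex.add_im, Complex.re_ofReal_mul, Complex.im_ofReal_mul,
      Complex.ofReal_re, Complex.ofReal_im, Complex.I_re, Complex.I_im, Complex.zero_re,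
      Complex.zero_im, mul_zero, mul_one, add_zero, zero_add]
  rw [hsplit]
  have h0 : 0 ≤ ω * τ := by positivity
  have hs : 0 ≤ Real.sin (ω * τ) := Real.sin_nonneg_of_nonneg_of_le_pi h0 hωτ
  have hsc := Real.sin_sq_add_cos_sq (ω * τ)
  have key : Real.cos (ω * τ) = -a / b → Real.sqrt (b ^ 2 - a ^ 2) = b * Real.sin (ω * τ) := by
    intro hc
    have h3 : b * Real.cos (ω * τ) = -a := by rw [hc]; field_simp
    have h4 : b ^ 2 - a ^ 2 = (b * Real.sin (ω * τ)) ^ 2 := by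
      have : a = -(b * Real.cos (ω * τ)) := by linarith
      rw [this]; linear_combination (-b ^ 2) * hsc
    rw [h4, Real.sqrt_sq (by positivity)]
  constructor
  · rintro ⟨h1, h2⟩
    have hc : Real.cos (ω * τ) = -a / b := by
      rw [eq_div_iff hb.ne']
      apply mul_left_cancel₀ hη.ne'
      linarith
    have hw : ω = η * Real.sqrt (b ^ 2 - a ^ 2) := by rw [key hc]; linarith
    refine ⟨hw, ?_⟩
    rw [← hc, Real.arccos_cos h0 hωτ]
    linear_combination (-τ) * hw
  · rintro ⟨hw, h2⟩
    have h5 : ω * τ = Real.arccos (-a / b) := by rw [← h2]; linear_combination τ * hw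
    have hc : Real.cos (ω * τ) = -a / b := by
      rw [h5, Real.cos_arccos]
      · rw [le_div_iff₀ hb]; linarith
      · rw [div_le_iff₀ hb]; linarith
    constructor
    · rw [hc]; field_simp; ring
    · rw [key hc] at hw; linarith
end

section
/- Let a, b, η, τ be real numbers with 0 ≤ a < b, η > 0, τ > 0, suppose ητ√(b² − a²) = arccos(−a/b), and set ω₀ = η√(b² − a²). Then the complex number −(a + b e^(−iω₀τ)) / (1 − ηbτ e^(−iω₀τ)) is well defined (the denominator is nonzero) and its real part equals ητ(b² − a²) / (1 + 2ηaτ + η²b²τ²), which is strictly positive. -/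
open Real

/-- Transversality condition: at the critical (Hopf) value of `η`, with
`ω₀ = η √(b² − a²)`, the complex number
`−(a + b e^{−iω₀τ}) / (1 − ηbτ e^{−iω₀τ})` is well defined and its real part
equals `ητ(b² − a²)/(1 + 2ηaτ + η²b²τ²) > 0`. -/
theorem bd_transversality (a b η τ : ℝ)
    (ha : 0 ≤ a) (hab : a < b) (hη : 0 < η) (hτ : 0 < τ)
    (hcrit : η * τ * Real.sqrt (b ^ 2 - a ^ 2) = Real.arccos (-a / b))
    (ω₀ : ℝ) (hω₀ : ω₀ = η * Real.sqrt (b ^ 2 - a ^ 2)) :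
    (1 - (η : ℂ) * b * τ * Complex.exp (-(Complex.I * ω₀) * τ)) ≠ 0 ∧
    (-((a : ℂ) + (b : ℂ) * Complex.exp (-(Complex.I * ω₀) * τ)) /
        (1 - (η : ℂ) * b * τ * Complex.exp (-(Complex.I * ω₀) * τ))).re =
      η * τ * (b ^ 2 - a ^ 2) / (1 + 2 * η * a * τ + η ^ 2 * b ^ 2 * τ ^ 2) ∧
    0 < η * τ * (b ^ 2 - a ^ 2) / (1 + 2 * η * a * τ + η ^ 2 * b ^ 2 * τ ^ 2) := by
  have hb : 0 < b := lt_of_le_of_lt ha hab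
  have hpos : 0 < b ^ 2 - a ^ 2 := by nlinarith
  have hden : 0 < 1 + 2 * η * a * τ + η ^ 2 * b ^ 2 * τ ^ 2 := by positivity
  have hθ : ω₀ * τ = Real.arccos (-a / b) := by rw [hω₀, ← hcrit]; ring
  have hcos : b * Real.cos (ω₀ * τ) = -a := by
    rw [hθ, Real.cos_arccos]
    · field_simp
    · rw [le_div_iff₀ hb]; linarith
    · rw [div_le_iff₀ hb]; linarith
  obtain ⟨S, hS⟩ : ∃ S, S = b * Real.sin (ω₀ * τ) := ⟨_, rfl⟩
  have hS2 : S ^ 2 = b ^ 2 - a ^ 2 := by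
    have h := Real.sin_sq_add_cos_sq (ω₀ * τ)
    have h2 : a ^ 2 = b ^ 2 * Real.cos (ω₀ * τ) ^ 2 := by
      rw [← mul_pow, hcos]; ring
    rw [hS, h2]
    linear_combination b ^ 2 * h
  have hE : (b : ℂ) * Complex.exp (-(Complex.I * ω₀) * τ) = ⟨-a, -S⟩ := by
    have h1 : -(Complex.I * ω₀) * τ = ((-(ω₀ * τ) : ℝ) : ℂ) * Complex.I := by
      push_cast; ring
    rw [h1]
    apply Complex.ext
    · rw [Complex.re_ofReal_mul, Complex.exp_ofReal_mul_I_re, Real.cos_neg, hcos]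
    · rw [Complex.im_ofReal_mul, Complex.exp_ofReal_mul_I_im, Real.sin_neg, hS]; ring
  have hD : (1 - (η : ℂ) * b * τ * Complex.exp (-(Complex.I * ω₀) * τ))
      = ⟨1 + η * τ * a, η * τ * S⟩ := by
    have h1 : (1 - (η : ℂ) * b * τ * Complex.exp (-(Complex.I * ω₀) * τ))
      = 1 - ((η * τ : ℝ) : ℂ) * ((b : ℂ) * Complex.exp (-(Complex.I * ω₀) * τ)) := by
      push_cast; ring
    rw [h1, hE]
    apply Complex.ext
    · rw [Complex.sub_re, Complex.re_ofReal_mul, Complex.one_re]; ring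
    · rw [Complex.sub_im, Complex.im_ofReal_mul, Complex.one_im]; ring
  have hN : -((a : ℂ) + ⟨-a, -S⟩) = ⟨0, S⟩ := by
    apply Complex.ext <;> simp
  rw [hD, hE, hN]
  refine ⟨?_, ?_, by positivity⟩
  · intro h
    have h1 := congrArg Complex.re h
    simp only [Complex.zero_re] at h1
    have : 0 < 1 + η * τ * a := by positivity
    linarith
  · rw [Complex.div_re, Complex.normSq_mk]
    have : (1 + η * τ * a) * (1 + η * τ * a) + η * τ * S * (η * τ * S)
        = 1 + 2 * η * a * τ + η ^ 2 * b ^ 2 * τ ^ 2 := by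
      linear_combination (η * τ) ^ 2 * hS2
    rw [this, ← hS2]
    ring
end

section
/- Let a, b, η, τ be real numbers with 0 ≤ a < b, η > 0, τ > 0. Then every complex root λ of the characteristic equation λ + ηa + ηb e^(−λτ) = 0 satisfies Re λ < 0 if and only if ητ√(b² − a²) < arccos(−a/b). -/
open Real

lemma bd_fwd (A B x y : ℝ) (hA : 0 ≤ A) (hAB : A < B) (hx : 0 ≤ x)
    (h1 : x + A + B * (Real.exp (-x) * Real.cos y) = 0)
    (h2 : y - B * (Real.exp (-x) * Real.sin y) = 0)
    (h : Real.sqrt (B ^ 2 - A ^ 2) < Real.arccos (-A / B)) : False := by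
  have hB : 0 < B := by linarith
  have he0 := Real.exp_pos (-x)
  have he1 : Real.exp (-x) ≤ 1 := Real.exp_le_one_iff.2 (by linarith)
  set E := Real.exp (-x) with hE
  have hs : (x + A) ^ 2 + y ^ 2 = B ^ 2 * E ^ 2 := by
    have e1 : x + A = -(B * (E * Real.cos y)) := by linarith
    have e2 : y = B * (E * Real.sin y) := by linarith
    have e3 := Real.sin_sq_add_cos_sq y
    have e4 : y ^ 2 = (B * (E * Real.sin y)) ^ 2 := congrArg (· ^ 2) e2
    rw [e1, e4]
    linear_combination B ^ 2 * E ^ 2 * e3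
  have hE2 : E ^ 2 ≤ 1 := by nlinarith
  have hy2 : y ^ 2 ≤ B ^ 2 - A ^ 2 := by
    nlinarith [mul_le_mul_of_nonneg_left hE2 (sq_nonneg B), mul_nonneg hx hA, sq_nonneg x]
  have hy : |y| ≤ Real.sqrt (B ^ 2 - A ^ 2) := Real.abs_le_sqrt hy2
  have hlt := lt_of_le_of_lt hy h
  have hc : Real.cos (Real.arccos (-A / B)) < Real.cos |y| :=
    Real.cos_lt_cos_of_nonneg_of_le_pi (abs_nonneg y) (Real.arccos_le_pi _) hlt
  rw [Real.cos_abs, Real.cos_arccos, div_lt_iff₀ hB] at hc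
  · nlinarith [mul_pos he0 (sub_pos.2 hc), mul_le_mul_of_nonneg_right he1 hA]
  · rw [le_div_iff₀ hB]; linarith
  · rw [div_le_iff₀ hB]; linarith

lemma bd_bwd (A B : ℝ) (hA : 0 ≤ A) (hAB : A < B)
    (h : Real.arccos (-A / B) ≤ Real.sqrt (B ^ 2 - A ^ 2)) :
    ∃ x y : ℝ, 0 ≤ x ∧ x + A + B * (Real.exp (-x) * Real.cos y) = 0 ∧
      y - B * (Real.exp (-x) * Real.sin y) = 0 := by
  have hB : 0 < B := by linarith
  have hpi := Real.pi_pos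
  set θ := Real.arccos (-A / B) with hθ
  have hcos : B * Real.cos θ = -A := by
    rw [hθ, Real.cos_arccos]
    · field_simp
    · rw [le_div_iff₀ hB]; linarith
    · rw [div_le_iff₀ hB]; linarith
  have hθpi : θ ≤ π := Real.arccos_le_pi _
  have hθ2 : π / 2 ≤ θ := by
    by_contra! hc
    have := Real.arccos_lt_pi_div_two.1 hc
    have h0 : -A / B ≤ 0 := div_nonpos_of_nonpos_of_nonneg (by linarith) hB.le
    linarith
  have hsin : B * Real.sin θ = Real.sqrt (B ^ 2 - A ^ 2) := by
    symm
    have h0 : 0 ≤ Real.sin θ := Real.sin_nonneg_of_nonneg_of_le_pi (by linarith) hθpi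
    rw [Real.sqrt_eq_iff_mul_self_eq (by nlinarith) (by positivity)]
    have e3 := Real.sin_sq_add_cos_sq θ
    linear_combination (-B ^ 2) * e3 + (B * Real.cos θ - A) * hcos
  obtain ⟨y1, ⟨hy1, hy1'⟩, hz⟩ : (0:ℝ) ∈ (fun y => B * Real.sin y - y) '' Set.Icc θ π := by
    apply intermediate_value_Icc' hθpi (by fun_prop)
    constructor
    · simp; exact hpi.le
    · show 0 ≤ B * Real.sin θ - θ
      linarith
  simp only at hz
  have hy1pi : y1 < π := by
    rcases lt_or_eq_of_le hy1' with h' | h'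
    · exact h'
    · rw [h', Real.sin_pi] at hz; linarith
  have hpos : ∀ y ∈ Set.Icc θ y1, 0 < y ∧ 0 < Real.sin y := fun y hy =>
    ⟨by linarith [hy.1], Real.sin_pos_of_pos_of_lt_pi (by linarith [hy.1]) (by linarith [hy.2])⟩
  have hcont : ContinuousOn (fun y => Real.log (B * Real.sin y / y) + A
      + y * Real.cos y / Real.sin y) (Set.Icc θ y1) := by
    apply ContinuousOn.add
    · apply ContinuousOn.add _ continuousOn_const
      apply ContinuousOn.log
      · exact ContinuousOn.div (by fun_prop) (by fun_prop) fun y hy => (hpos y hy).1.ne'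
      · intro y hy
        have := hpos y hy
        have h1 := this.1
        have h2 := this.2
        positivity
    · exact ContinuousOn.div (by fun_prop) (by fun_prop) fun y hy => (hpos y hy).2.ne'
  obtain ⟨y, hy, hg⟩ : (0:ℝ) ∈ (fun y => Real.log (B * Real.sin y / y) + A
      + y * Real.cos y / Real.sin y) '' Set.Icc θ y1 := by
    apply intermediate_value_Icc' hy1 hcont
    constructor
    · obtain ⟨p1, p2⟩ := hpos y1 ⟨hy1, le_rfl⟩
      have e : B * Real.sin y1 = y1 := by linarith
      have hc : Real.cos y1 ≤ Real.cos θ :=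
        Real.cos_le_cos_of_nonneg_of_le_pi (by linarith) hy1' hy1
      have e2 : y1 * Real.cos y1 / Real.sin y1 = B * Real.cos y1 := by
        rw [div_eq_iff p2.ne']
        linear_combination (-Real.cos y1) * e
      show Real.log (B * Real.sin y1 / y1) + A + y1 * Real.cos y1 / Real.sin y1 ≤ 0
      rw [e2, e, div_self p1.ne', Real.log_one]
      nlinarith
    · obtain ⟨p1, p2⟩ := hpos θ ⟨le_rfl, hy1⟩
      show 0 ≤ Real.log (B * Real.sin θ / θ) + A + θ * Real.cos θ / Real.sin θ
      have l : 0 ≤ Real.log (B * Real.sin θ / θ) := by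
        apply Real.log_nonneg
        rw [le_div_iff₀ p1]; linarith
      have : -A ≤ θ * Real.cos θ / Real.sin θ := by
        rw [le_div_iff₀ p2]
        have hc0 : Real.cos θ ≤ 0 := by
          by_contra! hc
          nlinarith
        nlinarith
      linarith
  simp only at hg
  obtain ⟨p1, p2⟩ := hpos y hy
  have hq : 0 < B * Real.sin y / y := by positivity
  refine ⟨Real.log (B * Real.sin y / y), y, ?_, ?_, ?_⟩
  · apply Real.log_nonneg
    rw [le_div_iff₀ p1]
    have : Real.sin y1 ≤ Real.sin y := by
      rw [← Real.cos_sub_pi_div_two, ← Real.cos_sub_pi_div_two]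
      exact Real.cos_le_cos_of_nonneg_of_le_pi (by linarith [hy.1]) (by linarith)
        (by linarith [hy.2])
    nlinarith [hy.2]
  · rw [Real.exp_neg, Real.exp_log hq, ← hg]
    field_simp
  · rw [Real.exp_neg, Real.exp_log hq]
    field_simp
    ring

/-- Necessary and sufficient condition for all characteristic roots of
`λ + ηa + ηb e^{−λτ} = 0` (with `0 ≤ a < b`, `η > 0`, `τ > 0`) to lie in the
open left half-plane: `ητ √(b² − a²) < arccos(−a/b)`. -/
theorem bd_local_stability_iff (a b η τ : ℝ)
    (ha : 0 ≤ a) (hab : a < b) (hη : 0 < η) (hτ : 0 < τ) :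
    (∀ lam : ℂ, lam + (η : ℂ) * a + (η : ℂ) * b * Complex.exp (-lam * τ) = 0 →
        lam.re < 0) ↔
      η * τ * Real.sqrt (b ^ 2 - a ^ 2) < Real.arccos (-a / b) := by
  have hb : 0 < b := by linarith
  have hητ : 0 < η * τ := by positivity
  have hs : Real.sqrt ((η * τ * b) ^ 2 - (η * τ * a) ^ 2) =
      η * τ * Real.sqrt (b ^ 2 - a ^ 2) := by
    rw [show (η * τ * b) ^ 2 - (η * τ * a) ^ 2 = (η * τ) ^ 2 * (b ^ 2 - a ^ 2) by ring,
      Real.sqrt_mul (by positivity), Real.sqrt_sq hητ.le]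
  have hd : -(η * τ * a) / (η * τ * b) = -a / b := by
    field_simp
  have hA : 0 ≤ η * τ * a := by positivity
  have hAB : η * τ * a < η * τ * b := by gcongr
  have key : ∀ lam : ℂ, lam + (η : ℂ) * a + (η : ℂ) * b * Complex.exp (-lam * τ) = 0 ↔
      (lam.re * τ + η * τ * a + η * τ * b *
        (Real.exp (-(lam.re * τ)) * Real.cos (lam.im * τ)) = 0 ∧
       lam.im * τ - η * τ * b *
        (Real.exp (-(lam.re * τ)) * Real.sin (lam.im * τ)) = 0) := by
    intro lam
    rw [Complex.ext_iff]
    simp only [Complex.add_re, Complex.add_im, Complex.mul_re, Complex.mul_im, Complex.exp_re,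
      Complex.exp_im, Complex.neg_re, Complex.neg_im, Complex.ofReal_re, Complex.ofReal_im,
      Complex.zero_re, Complex.zero_im, mul_zero, zero_mul, sub_zero, add_zero, zero_add, neg_mul,
      Real.cos_neg, Real.sin_neg]
    apply and_congr
    · rw [← mul_left_inj' hτ.ne', zero_mul]
      ring_nf
    · rw [← mul_left_inj' hτ.ne', zero_mul]
      ring_nf
  rw [← hs, ← hd]
  constructor
  · intro H
    by_contra! hc
    obtain ⟨x, y, hx, h1, h2⟩ := bd_bwd _ _ hA hAB hc
    have := H ⟨x / τ, y / τ⟩ ((key _).2 (by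
      simp only [div_mul_cancel₀ _ hτ.ne']
      exact ⟨h1, h2⟩))
    have h3 : 0 ≤ x / τ := by positivity
    simp only at this
    linarith
  · intro H lam hl
    by_contra! hc
    obtain ⟨h1, h2⟩ := (key lam).1 hl
    exact bd_fwd _ _ _ _ hA hAB (by positivity) h1 h2 H
end

section
/- Let a, b, η, τ be real numbers with 0 ≤ a < b, η > 0, τ > 0, and suppose ητ√(b² − a²) > arccos(−a/b). Then the characteristic equation λ + ηa + ηb e^(−λτ) = 0 has a complex root λ with Re λ > 0. -/
open Real

lemma bd_aux (A B θ : ℝ) (hA : 0 ≤ A) (hB : 0 < B) (h1 : π / 2 ≤ θ) (h2 : θ < π)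
    (hc : A + B * cos θ = 0) (hs : θ < B * sin θ) :
    ∃ x y : ℝ, 0 < x ∧ x + A + B * (exp (-x) * cos y) = 0 ∧ y = B * (exp (-x) * sin y) := by
  have hpi := Real.pi_pos
  obtain ⟨y0, ⟨hy1, hy2⟩, hy0⟩ : (0:ℝ) ∈ (fun y => B * sin y - y) '' Set.Icc θ π := by
    apply intermediate_value_Icc' h2.le (by fun_prop)
    simp only [Set.mem_Icc, Real.sin_pi]
    constructor <;> linarith
  simp only at hy0
  have hne : θ ≠ y0 := by rintro rfl; linarith
  have hne2 : y0 ≠ π := by rintro rfl; rw [Real.sin_pi] at hy0; linarith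
  have hlt : θ < y0 := lt_of_le_of_ne hy1 hne
  have hlt2 : y0 < π := lt_of_le_of_ne hy2 hne2
  have hsin : ∀ y ∈ Set.Icc θ y0, 0 < sin y := fun y hy =>
    Real.sin_pos_of_pos_of_lt_pi (by linarith [hy.1]) (by linarith [hy.2])
  have hcos : cos y0 < cos θ := Real.cos_lt_cos_of_nonneg_of_le_pi (by linarith) hy2 hlt
  have hcont : ContinuousOn (fun y => log (B * sin y / y) + A + y * cos y / sin y)
      (Set.Icc θ y0) := by
    have hy : ∀ y ∈ Set.Icc θ y0, y ≠ 0 := fun y hy => by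
      have := hy.1
      exact ne_of_gt (by linarith)
    have hsn : ∀ y ∈ Set.Icc θ y0, sin y ≠ 0 := fun y hy => (hsin y hy).ne'
    refine ContinuousOn.add (ContinuousOn.add (ContinuousOn.log ?_ ?_) continuousOn_const) ?_
    · exact ContinuousOn.div (by fun_prop) (by fun_prop) hy
    · intro y h
      exact div_ne_zero (mul_ne_zero hB.ne' (hsn y h)) (hy y h)
    · exact ContinuousOn.div (by fun_prop) (by fun_prop) hsn
  have hg0 : log (B * sin y0 / y0) + A + y0 * cos y0 / sin y0 < 0 := by
    have e : B * sin y0 = y0 := by linarith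
    have s0 := hsin y0 ⟨hy1, le_rfl⟩
    have e2 : y0 * cos y0 / sin y0 = B * cos y0 := by
      rw [div_eq_iff s0.ne']
      nth_rewrite 1 [← e]
      ring
    rw [e2, e, div_self (by linarith), Real.log_one]
    nlinarith
  have hθ : 0 < log (B * sin θ / θ) + A + θ * cos θ / sin θ := by
    have s0 := hsin θ ⟨le_rfl, hy1⟩
    have t0 : 0 < θ := by linarith
    have l : 0 < log (B * sin θ / θ) := Real.log_pos (by rw [lt_div_iff₀ t0]; linarith)
    have : 0 ≤ A + θ * cos θ / sin θ := by
      have : A + θ * cos θ / sin θ = (-cos θ) * (B * sin θ - θ) / sin θ := by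
        have : A = - B * cos θ := by linarith
        rw [this]; field_simp; ring
      rw [this]
      have hcn : 0 ≤ - cos θ := by
        by_contra! h
        nlinarith
      exact div_nonneg (mul_nonneg hcn (by linarith)) s0.le
    linarith
  obtain ⟨y, hy, hgy⟩ := intermediate_value_Icc' hlt.le hcont ⟨hg0.le, hθ.le⟩
  simp only at hgy
  have hyne : y ≠ y0 := by rintro rfl; linarith
  have hylt : y < y0 := lt_of_le_of_ne hy.2 hyne
  have sy := hsin y hy
  have y0' : 0 < y := by linarith [hy.1]
  have hss : sin y0 < sin y := by
    rw [← Real.sin_pi_sub y0, ← Real.sin_pi_sub y]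
    apply Real.sin_lt_sin_of_lt_of_le_pi_div_two <;> linarith [hy.1]
  have hgt : y < B * sin y := by nlinarith
  have hpos : 0 < B * sin y / y := by positivity
  refine ⟨log (B * sin y / y), y, Real.log_pos (by rw [lt_div_iff₀ y0']; linarith), ?_, ?_⟩
  · rw [Real.exp_neg, Real.exp_log hpos, ← hgy]
    field_simp
  · rw [Real.exp_neg, Real.exp_log hpos]
    field_simp

/-- If the stability condition is violated, i.e. `ητ √(b² − a²) > arccos(−a/b)`
with `0 ≤ a < b`, `η > 0`, `τ > 0`, then the characteristic equation
`λ + ηa + ηb e^{−λτ} = 0` has a root with positive real part. -/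
theorem bd_instability (a b η τ : ℝ)
    (ha : 0 ≤ a) (hab : a < b) (hη : 0 < η) (hτ : 0 < τ)
    (hcond : η * τ * Real.sqrt (b ^ 2 - a ^ 2) > Real.arccos (-a / b)) :
    ∃ lam : ℂ, lam + (η : ℂ) * a + (η : ℂ) * b * Complex.exp (-lam * τ) = 0 ∧
      0 < lam.re := by
  have hb : 0 < b := by linarith
  have hm1 : -1 < -a / b := by rw [lt_div_iff₀ hb]; linarith
  have h0 : -a / b ≤ 0 := div_nonpos_of_nonpos_of_nonneg (by linarith) hb.le
  have hcos : cos (arccos (-a / b)) = -a / b := Real.cos_arccos hm1.le (by linarith)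
  have hsin : b * sin (arccos (-a / b)) = sqrt (b ^ 2 - a ^ 2) := by
    rw [Real.sin_arccos]
    have : b ^ 2 - a ^ 2 = b ^ 2 * (1 - (-a / b) ^ 2) := by field_simp
    rw [this, Real.sqrt_mul (by positivity), Real.sqrt_sq hb.le]
  obtain ⟨x, y, hx, e1, e2⟩ := bd_aux (η * τ * a) (η * τ * b) (arccos (-a / b))
    (by positivity) (by positivity)
    (by
      by_contra! h
      have := Real.cos_pos_of_mem_Ioo ⟨by linarith [Real.arccos_nonneg (-a / b), Real.pi_pos], h⟩
      linarith)
    (by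
      refine lt_of_le_of_ne (Real.arccos_le_pi _) fun h => ?_
      rw [h, Real.cos_pi] at hcos
      linarith)
    (by rw [hcos]; field_simp; ring)
    (by rw [mul_assoc, hsin]; exact hcond)
  have ht : (τ : ℂ) ≠ 0 := by exact_mod_cast hτ.ne'
  refine ⟨((x / τ : ℝ) : ℂ) + ((y / τ : ℝ) : ℂ) * Complex.I, ?_, ?_⟩
  · have e : -(((x / τ : ℝ) : ℂ) + ((y / τ : ℝ) : ℂ) * Complex.I) * τ
        = ((-x : ℝ) : ℂ) + ((-y : ℝ) : ℂ) * Complex.I := by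
      push_cast
      field_simp
      ring
    rw [e, Complex.exp_add, Complex.exp_mul_I, ← Complex.ofReal_exp, ← Complex.ofReal_cos,
      ← Complex.ofReal_sin, Real.cos_neg, Real.sin_neg]
    have f1 : x / τ + η * a + η * b * (exp (-x) * cos y) = 0 := by
      have : x / τ + η * a + η * b * (exp (-x) * cos y)
        = (x + η * τ * a + η * τ * b * (exp (-x) * cos y)) / τ := by field_simp
      rw [this, e1, zero_div]
    have f2 : y / τ = η * b * (exp (-x) * sin y) := by
      rw [div_eq_iff hτ.ne']; linarith
    apply Complex.ext
    · simp [-Complex.ofReal_exp, -Complex.ofReal_cos, -Complex.ofReal_sin, -Complex.ofReal_div]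
      linarith
    · simp [-Complex.ofReal_exp, -Complex.ofReal_cos, -Complex.ofReal_sin, -Complex.ofReal_div]
      linarith
  · simp [-Complex.ofReal_div]
    positivity
end

section
/- Let a, b, η, τ be real numbers with 0 ≤ a < b, η > 0, τ > 0, and suppose ηbτ < π/2. Then every complex root λ of the characteristic equation λ + ηa + ηb e^(−λτ) = 0 satisfies Re λ < 0. -/
open Real

/-- Sufficient condition for stability: if `ηbτ < π/2` with `0 ≤ a < b`,
`η > 0`, `τ > 0`, then every root of the characteristic equation
`λ + ηa + ηb e^{−λτ} = 0` has negative real part. -/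
theorem bd_sufficient_stability (a b η τ : ℝ)
    (ha : 0 ≤ a) (hab : a < b) (hη : 0 < η) (hτ : 0 < τ)
    (hcond : η * b * τ < π / 2) :
    ∀ lam : ℂ, lam + (η : ℂ) * a + (η : ℂ) * b * Complex.exp (-lam * τ) = 0 →
      lam.re < 0 := by
  intro lam h
  by_contra hx
  have hx : 0 ≤ lam.re := not_lt.mp hx
  have hb : 0 < b := lt_of_le_of_lt ha hab
  have h1 := congrArg Complex.re h
  have h2 := congrArg Complex.im h
  simp [Complex.exp_re, Complex.exp_im] at h1 h2
  have hE : Real.exp (-(lam.re * τ)) ≤ 1 := Real.exp_le_one_iff.mpr (by nlinarith)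
  have hE0 := Real.exp_pos (-(lam.re * τ))
  have hηb : 0 < η * b := mul_pos hη hb
  have hy : |lam.im| ≤ η * b := by
    have e : lam.im = η * b * (Real.exp (-(lam.re * τ)) * Real.sin (lam.im * τ)) := by linarith
    rw [e, abs_mul, abs_of_pos hηb, abs_mul, abs_of_pos hE0]
    have := Real.abs_sin_le_one (lam.im * τ)
    have h3 : Real.exp (-(lam.re * τ)) * |Real.sin (lam.im * τ)| ≤ 1 :=
      mul_le_one₀ hE (abs_nonneg _) this
    nlinarith
  have hy2 : |lam.im * τ| < π / 2 := by
    rw [abs_mul, abs_of_pos hτ]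
    nlinarith
  have hc : 0 < Real.cos (lam.im * τ) := Real.cos_pos_of_mem_Ioo (abs_lt.mp hy2)
  have h4 : 0 < η * b * (Real.exp (-(lam.re * τ)) * Real.cos (lam.im * τ)) := by positivity
  have h5 : 0 ≤ η * a := by positivity
  linarith
end

section
/- For every real number ε with 0 ≤ ε < 1, one has arccos(−ε) ≥ (π/2)·√(1 − ε²), with equality if and only if ε = 0. Equivalently, the function ε ↦ arccos(−ε)/√(1 − ε²) attains its minimum value π/2 on [0,1) at ε = 0. -/
open Real

/-- For `0 ≤ ε < 1`, `arccos(−ε) ≥ (π/2)·√(1 − ε²)`, with equality iff `ε = 0`;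
equivalently, `ε ↦ arccos(−ε)/√(1 − ε²)` attains its minimum `π/2` on `[0,1)`
at `ε = 0`. -/
theorem arccos_ge_pi_div_two_mul_sqrt (ε : ℝ) (h0 : 0 ≤ ε) (h1 : ε < 1) :
    Real.arccos (-ε) ≥ π / 2 * Real.sqrt (1 - ε ^ 2) ∧
    (Real.arccos (-ε) = π / 2 * Real.sqrt (1 - ε ^ 2) ↔ ε = 0) := by
  have hs : Real.sqrt (1 - ε ^ 2) ≤ 1 := by
    rw [Real.sqrt_le_iff]
    constructor <;> nlinarith [sq_nonneg ε]
  have hp : π / 2 * Real.sqrt (1 - ε ^ 2) ≤ π / 2 := by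
    nlinarith [Real.pi_pos]
  have ha : Real.arccos (-ε) = π / 2 + Real.arcsin ε := by
    rw [Real.arccos, Real.arcsin_neg]
    ring
  have hn : 0 ≤ Real.arcsin ε := Real.arcsin_nonneg.2 h0
  refine ⟨by linarith, fun h => ?_, fun h => ?_⟩
  · have h2 : Real.arcsin ε = 0 := by linarith
    exact Real.arcsin_eq_zero_iff.1 h2
  · subst h
    simp
end

section
/- Let a be a real number and b, τ positive real numbers. Then the characteristic equation λ + a + b e^(−λτ) = 0 has a real root λ if and only if bτ e^(aτ) ≤ 1/e. -/
open Real

/-- The characteristic equation `λ + a + b e^{−λτ} = 0` (with `b, τ > 0`)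
has a real root iff `bτ e^{aτ} ≤ 1/e`. -/
theorem bd_real_root_iff (a b τ : ℝ) (hb : 0 < b) (hτ : 0 < τ) :
    (∃ lam : ℝ, lam + a + b * Real.exp (-lam * τ) = 0) ↔
      b * τ * Real.exp (a * τ) ≤ 1 / Real.exp 1 := by
  rw [le_div_iff₀ (Real.exp_pos 1)]
  constructor
  · rintro ⟨l, hl⟩
    have h1 := Real.add_one_le_exp (-(l + a) * τ - 1)
    have h2 : Real.exp (-l * τ) = Real.exp (a * τ) * Real.exp 1 * Real.exp (-(l + a) * τ - 1) := by
      rw [← Real.exp_add, ← Real.exp_add]; congr 1; ring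
    have hE := Real.exp_pos (-(l + a) * τ - 1)
    rw [h2] at hl
    have h3 : (b * τ * Real.exp (a * τ) * Real.exp 1) * Real.exp (-(l + a) * τ - 1)
        = -(l + a) * τ := by linear_combination τ * hl
    refine le_of_mul_le_mul_right ?_ hE
    rw [h3]; linarith
  · intro h
    have hc : ContinuousOn (fun l : ℝ => l + a + b * Real.exp (-l * τ))
        (Set.Icc (-a - 1 / τ) (-a)) := by fun_prop
    have hle : -a - 1 / τ ≤ -a := by
      have : 0 < 1 / τ := by positivity
      linarith
    have h0 : (0 : ℝ) ∈ Set.Icc ((-a - 1 / τ) + a + b * Real.exp (-(-a - 1 / τ) * τ))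
        (-a + a + b * Real.exp (-(-a) * τ)) := by
      constructor
      · have e : -(-a - 1 / τ) * τ = a * τ + 1 := by field_simp; ring
        rw [e, Real.exp_add]
        have : b * (Real.exp (a * τ) * Real.exp 1) ≤ 1 / τ := by
          rw [le_div_iff₀ hτ]; linarith
        linarith
      · have := Real.exp_pos (-(-a) * τ)
        have := mul_pos hb this
        linarith
    obtain ⟨l, -, hl⟩ := intermediate_value_Icc hle hc h0
    exact ⟨l, hl⟩
end

section
/- Let a be a real number and b, τ positive real numbers. Suppose λ = −σ + iω, with σ, ω real and 0 < ωτ < π, is a root of the characteristic equation λ + a + b e^(−λτ) = 0. Then bτ e^(aτ) = (ωτ / sin(ωτ)) · e^(−ωτ/tan(ωτ)), and consequently bτ e^(aτ) > 1/e. In particular, if bτ e^(aτ) ≤ 1/e, the characteristic equation has no root λ = −σ + iω with 0 < ωτ < π. -/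
open Real

/-- If `λ = −σ + iω` with `0 < ωτ < π` is a root of the characteristic
equation `λ + a + b e^{−λτ} = 0` (with `b, τ > 0`), then
`bτ e^{aτ} = (ωτ/sin(ωτ)) e^{−ωτ/tan(ωτ)}` and consequently `bτ e^{aτ} > 1/e`. -/
theorem bd_oscillatory_root (a b τ σ ω : ℝ) (hb : 0 < b) (hτ : 0 < τ)
    (hω1 : 0 < ω * τ) (hω2 : ω * τ < π)
    (hroot : (Complex.mk (-σ) ω) + (a : ℂ) + (b : ℂ) *
      Complex.exp (-(Complex.mk (-σ) ω) * τ) = 0) :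
    b * τ * Real.exp (a * τ) =
      (ω * τ / Real.sin (ω * τ)) * Real.exp (-(ω * τ) / Real.tan (ω * τ)) ∧
    b * τ * Real.exp (a * τ) > 1 / Real.exp 1 := by
  have hs : 0 < Real.sin (ω * τ) := Real.sin_pos_of_pos_of_lt_pi hω1 hω2
  have hre := congrArg Complex.re hroot
  have him := congrArg Complex.im hroot
  simp [Complex.exp_re, Complex.exp_im] at hre him
  have hcot : -(ω * τ) / Real.tan (ω * τ) = -(ω * τ) * Real.cos (ω * τ) / Real.sin (ω * τ) := by
    rw [Real.tan_eq_sin_div_cos, div_div_eq_mul_div]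
  have hω : ω = b * Real.exp (σ * τ) * Real.sin (ω * τ) := by linarith
  have hσ : σ - a = b * Real.exp (σ * τ) * Real.cos (ω * τ) := by linarith
  have hexp : -(ω * τ) * Real.cos (ω * τ) / Real.sin (ω * τ) = a * τ - σ * τ := by
    rw [div_eq_iff hs.ne']
    linear_combination (-τ * Real.cos (ω * τ)) * hω + τ * Real.sin (ω * τ) * hσ
  have hdiv : ω * τ / Real.sin (ω * τ) = b * τ * Real.exp (σ * τ) := by
    rw [div_eq_iff hs.ne']
    linear_combination τ * hω
  have key : b * τ * Real.exp (a * τ) =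
      (ω * τ / Real.sin (ω * τ)) * Real.exp (-(ω * τ) / Real.tan (ω * τ)) := by
    rw [hcot, hexp, hdiv, mul_assoc (b * τ), ← Real.exp_add]
    congr 2
    ring
  refine ⟨key, ?_⟩
  rw [key, gt_iff_lt, one_div, ← Real.exp_neg]
  have h1 : 1 < ω * τ / Real.sin (ω * τ) := by
    rw [one_lt_div hs]
    exact Real.sin_lt hω1
  have hc : ω * τ * Real.cos (ω * τ) < Real.sin (ω * τ) := by
    rcases lt_or_ge (ω * τ) (π / 2) with h | h
    · have hcp : 0 < Real.cos (ω * τ) := Real.cos_pos_of_mem_Ioo ⟨by linarith, h⟩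
      have ht := Real.lt_tan hω1 h
      rwa [Real.tan_eq_sin_div_cos, lt_div_iff₀ hcp] at ht
    · have hcn : Real.cos (ω * τ) ≤ 0 :=
        Real.cos_nonpos_of_pi_div_two_le_of_le h (by linarith)
      have := mul_nonpos_of_nonneg_of_nonpos hω1.le hcn
      linarith
  have h2 : Real.exp (-1) < Real.exp (-(ω * τ) / Real.tan (ω * τ)) := by
    rw [hcot, Real.exp_lt_exp, lt_div_iff₀ hs]
    linarith
  have h3 := Real.exp_pos (-(ω * τ) / Real.tan (ω * τ))
  nlinarith
end

section
/- Let a be a real number and b, τ positive real numbers with bτ e^(aτ) = 1/e. Then every real root λ of the characteristic equation λ + a + b e^(−λτ) = 0 equals −(a + 1/τ); that is, at the boundary of the non-oscillatory regime the real characteristic root is λ = −(a + 1/τ), corresponding to convergence rate σ = a + 1/τ. -/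
open Real

/-- At the boundary of the non-oscillatory regime, `bτ e^{aτ} = 1/e`, every
real root of the characteristic equation `λ + a + b e^{−λτ} = 0` equals
`−(a + 1/τ)`. -/
theorem bd_boundary_root (a b τ : ℝ) (hb : 0 < b) (hτ : 0 < τ)
    (hboundary : b * τ * Real.exp (a * τ) = 1 / Real.exp 1) :
    ∀ lam : ℝ, lam + a + b * Real.exp (-lam * τ) = 0 → lam = -(a + 1 / τ) := by
  intro lam h
  have h1 : Real.exp (-lam * τ)
      = Real.exp (a * τ) * Real.exp ((-lam - a) * τ - 1) * Real.exp 1 := by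
    rw [← Real.exp_add, ← Real.exp_add]
    congr 1
    ring
  have h2 : (-lam - a) * τ = Real.exp ((-lam - a) * τ - 1) := by
    have h3 : b * τ * Real.exp (a * τ) * Real.exp 1 = 1 := by
      rw [hboundary]
      field_simp
    rw [h1] at h
    linear_combination (-τ) * h + Real.exp ((-lam - a) * τ - 1) * h3
  have h4 : (-lam - a) * τ - 1 = 0 := by
    by_contra hne
    have := Real.add_one_lt_exp hne
    linarith
  have h5 : (-lam - a) = 1 / τ := by
    rw [eq_div_iff hτ.ne']
    linarith
  linarith
end

section
/- Let a be a real number and b, τ positive real numbers, and suppose the characteristic equation λ + a + b e^(−λτ) = 0 has a real root. Then its largest real root λ₀ satisfies λ₀ ≥ −(a + 1/τ); equivalently, the associated decay rate σ = −λ₀ satisfies (σ − a)τ ≤ 1, so the rate of convergence never exceeds a + 1/τ. -/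
open Real

/-- If the characteristic equation `λ + a + b e^{−λτ} = 0` (with `b, τ > 0`)
has a real root, then it has a largest real root `λ₀`, and
`λ₀ ≥ −(a + 1/τ)`: the rate of convergence never exceeds `a + 1/τ`. -/
theorem bd_largest_root_bound (a b τ : ℝ) (hb : 0 < b) (hτ : 0 < τ)
    (hex : ∃ lam : ℝ, lam + a + b * Real.exp (-lam * τ) = 0) :
    ∃ lam₀ : ℝ,
      IsGreatest {lam : ℝ | lam + a + b * Real.exp (-lam * τ) = 0} lam₀ ∧
      lam₀ ≥ -(a + 1 / τ) := by
  have hcont : Continuous (fun l : ℝ => l + a + b * Real.exp (-l * τ)) := by fun_prop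
  have hbdd : BddAbove {lam : ℝ | lam + a + b * Real.exp (-lam * τ) = 0} := by
    refine ⟨-a, fun l hl => ?_⟩
    have h1 : l + a + b * Real.exp (-l * τ) = 0 := hl
    have h2 : 0 < b * Real.exp (-l * τ) := by positivity
    linarith
  have hclosed : IsClosed {lam : ℝ | lam + a + b * Real.exp (-lam * τ) = 0} :=
    isClosed_eq hcont continuous_const
  have hmem := hclosed.csSup_mem hex hbdd
  refine ⟨_, ⟨hmem, fun l hl => le_csSup hbdd hl⟩, ?_⟩
  obtain ⟨l, hl⟩ := hex
  have hτ' : 0 < 1 / τ := by positivity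
  have hm : -(a + 1 / τ) + a + b * Real.exp (-(-(a + 1 / τ)) * τ) ≤ 0 := by
    have e1 : -(-(a + 1 / τ)) * τ = -l * τ + -((-(l + a)) * τ - 1) := by
      field_simp
      ring
    have e2 : b * Real.exp (-l * τ) = -(l + a) := by linarith
    rw [e1, Real.exp_add, ← mul_assoc, e2]
    have h3 := Real.add_one_le_exp ((-(l + a)) * τ - 1)
    have h4 : (-(l + a)) * τ * Real.exp (-((-(l + a)) * τ - 1)) ≤ 1 := by
      rw [Real.exp_neg, ← div_eq_mul_inv, div_le_one (Real.exp_pos _)]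
      linarith
    have h5 : -(l + a) * Real.exp (-((-(l + a)) * τ - 1)) ≤ 1 / τ := by
      rw [le_div_iff₀ hτ]
      linarith
    linarith
  have hp : 0 ≤ -a + a + b * Real.exp (-(-a) * τ) := by
    have : 0 < b * Real.exp (-(-a) * τ) := by positivity
    linarith
  obtain ⟨r, hr, hr0⟩ := intermediate_value_Icc (by linarith : -(a + 1 / τ) ≤ -a)
    hcont.continuousOn (show (0 : ℝ) ∈ Set.Icc _ _ from ⟨hm, hp⟩)
  exact hr.1.trans (le_csSup hbdd hr0)
end

section
/- Let a, b be positive real numbers and let 0 < τ₁ < τ₂ be such that bτ₂ e^(aτ₂) ≤ 1/e. For i = 1, 2, let σᵢ be the smallest real solution of σ = a + b e^(στᵢ) (these solutions exist). Then a + b < σ₁ < σ₂; that is, the rate of convergence to the equilibrium is a strictly increasing function of the delay on the non-oscillatory regime (0, τ*), starting from the value a + b at τ = 0. -/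
open Real

lemma least_aux (a b τ c : ℝ) (hb : 0 < b) (hτ : 0 < τ)
    (hc : a + b * Real.exp (c * τ) ≤ c) :
    ∃ σ, IsLeast {σ : ℝ | σ = a + b * Real.exp (σ * τ)} σ ∧ σ ≤ c := by
  have hcl : IsClosed {s : ℝ | a + b * Real.exp (s * τ) ≤ s} :=
    isClosed_le (by fun_prop) (by fun_prop)
  have hbd : BddBelow {s : ℝ | a + b * Real.exp (s * τ) ≤ s} := by
    refine ⟨a, fun s hs => ?_⟩
    have h1 : a + b * Real.exp (s * τ) ≤ s := hs
    have h2 : 0 < b * Real.exp (s * τ) := by positivity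
    linarith
  have hm := hcl.csInf_mem ⟨c, hc⟩ hbd
  have hle : ∀ s, a + b * Real.exp (s * τ) ≤ s →
      sInf {s : ℝ | a + b * Real.exp (s * τ) ≤ s} ≤ s := fun s hs => csInf_le hbd hs
  generalize sInf {s : ℝ | a + b * Real.exp (s * τ) ≤ s} = m at hm hle
  have hm' : a + b * Real.exp (m * τ) ≤ m := hm
  refine ⟨m, ⟨?_, fun s hs => hle s (le_of_eq (Eq.symm hs))⟩, hle c hc⟩
  refine le_antisymm (hle _ ?_) hm'
  gcongr

/-- On the non-oscillatory regime, the rate of convergence is strictly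
increasing in the delay: for `0 < τ₁ < τ₂` with `bτ₂ e^{aτ₂} ≤ 1/e`, the
smallest real solutions `σᵢ` of `σ = a + b e^{στᵢ}` exist and satisfy
`a + b < σ₁ < σ₂`. -/
theorem bd_roc_increasing (a b τ₁ τ₂ : ℝ) (ha : 0 < a) (hb : 0 < b)
    (hτ₁ : 0 < τ₁) (hτ₁₂ : τ₁ < τ₂)
    (hnonosc : b * τ₂ * Real.exp (a * τ₂) ≤ 1 / Real.exp 1) :
    ∃ σ₁ σ₂ : ℝ,
      IsLeast {σ : ℝ | σ = a + b * Real.exp (σ * τ₁)} σ₁ ∧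
      IsLeast {σ : ℝ | σ = a + b * Real.exp (σ * τ₂)} σ₂ ∧
      a + b < σ₁ ∧ σ₁ < σ₂ := by
  have hτ₂ : 0 < τ₂ := hτ₁.trans hτ₁₂
  have hc : a + b * Real.exp ((a + 1 / τ₂) * τ₂) ≤ a + 1 / τ₂ := by
    have e : (a + 1 / τ₂) * τ₂ = a * τ₂ + 1 := by field_simp
    rw [e, Real.exp_add]
    rw [le_div_iff₀ (Real.exp_pos 1)] at hnonosc
    have : b * (Real.exp (a * τ₂) * Real.exp 1) ≤ 1 / τ₂ := by
      rw [le_div_iff₀ hτ₂]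
      linarith
    linarith
  obtain ⟨σ₂, h₂, -⟩ := least_aux a b τ₂ _ hb hτ₂ hc
  have e₂ : σ₂ = a + b * Real.exp (σ₂ * τ₂) := h₂.1
  have p₂ : 0 < σ₂ := by rw [e₂]; positivity
  have hlt : a + b * Real.exp (σ₂ * τ₁) < σ₂ := by
    conv_rhs => rw [e₂]
    gcongr
  obtain ⟨σ₁, h₁, hle⟩ := least_aux a b τ₁ σ₂ hb hτ₁ hlt.le
  have e₁ : σ₁ = a + b * Real.exp (σ₁ * τ₁) := h₁.1
  have p₁ : 0 < σ₁ := by rw [e₁]; positivity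
  refine ⟨σ₁, σ₂, h₁, h₂, ?_, lt_of_le_of_ne hle ?_⟩
  · have : 1 < Real.exp (σ₁ * τ₁) := Real.one_lt_exp_iff.2 (by positivity)
    nlinarith
  · rintro rfl
    linarith
end

section
/- For every real number ε with 0 ≤ ε < 1, one has √(1 − ε²)·(12ε − 18) + arccos(−ε)·(8ε² − 18ε + 4) < 0. -/
open Real

/-- For all `0 ≤ ε < 1`,
`√(1 − ε²)(12ε − 18) + arccos(−ε)(8ε² − 18ε + 4) < 0`. -/
theorem quadratic_model_subcritical (ε : ℝ) (h0 : 0 ≤ ε) (h1 : ε < 1) :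
    Real.sqrt (1 - ε ^ 2) * (12 * ε - 18) +
      Real.arccos (-ε) * (8 * ε ^ 2 - 18 * ε + 4) < 0 := by
  have ha : 0 ≤ Real.arccos (-ε) := Real.arccos_nonneg _
  have hb : Real.arccos (-ε) ≤ 3.15 := (Real.arccos_le_pi _).trans Real.pi_lt_d2.le
  rcases le_or_gt (1 / 4) ε with h | h
  · have hs : 0 < Real.sqrt (1 - ε ^ 2) := Real.sqrt_pos.mpr (by nlinarith)
    have hq : 8 * ε ^ 2 - 18 * ε + 4 ≤ 0 := by nlinarith
    have e1 := mul_neg_of_pos_of_neg hs (by linarith : 12 * ε - 18 < 0)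
    have e2 := mul_nonpos_of_nonneg_of_nonpos ha hq
    linarith
  · have hs : 0.9 ≤ Real.sqrt (1 - ε ^ 2) := Real.le_sqrt_of_sq_le (by nlinarith)
    have hq : 8 * ε ^ 2 - 18 * ε + 4 ≤ 4 := by nlinarith
    have e1 : 0.9 * 15 ≤ Real.sqrt (1 - ε ^ 2) * (18 - 12 * ε) :=
      mul_le_mul hs (by linarith) (by norm_num) (by linarith)
    have e2 := mul_le_mul_of_nonneg_left hq ha
    linarith
end

section
/- For every real number ε with 0 < ε < 1, one has ((1 − ε) / ((1 + ε)² · arccos(−ε) · (5 − 4ε))) · [√(1 − ε²)·(−8ε³ − 8ε² + 26ε − 4) + arccos(−ε)·(−4ε² − 12ε + 22)] + ((2ε − 1) / ((1 − ε²) · arccos(−ε))) · [3ε·√(1 − ε²) + 3·arccos(−ε)] > 0. -/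
open Real

/-- For all `0 < ε < 1`, the first Lyapunov coefficient expression for
Nicholson's blowflies equation is positive:
`((1−ε)/((1+ε)² arccos(−ε) (5−4ε)))·(√(1−ε²)(−8ε³−8ε²+26ε−4) + arccos(−ε)(−4ε²−12ε+22))
 + ((2ε−1)/((1−ε²) arccos(−ε)))·(3ε√(1−ε²) + 3 arccos(−ε)) > 0`. -/
theorem nicholson_supercritical (ε : ℝ) (h0 : 0 < ε) (h1 : ε < 1) :
    ((1 - ε) / ((1 + ε) ^ 2 * Real.arccos (-ε) * (5 - 4 * ε))) *
        (Real.sqrt (1 - ε ^ 2) * (-8 * ε ^ 3 - 8 * ε ^ 2 + 26 * ε - 4) +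
          Real.arccos (-ε) * (-4 * ε ^ 2 - 12 * ε + 22)) +
      ((2 * ε - 1) / ((1 - ε ^ 2) * Real.arccos (-ε))) *
        (3 * ε * Real.sqrt (1 - ε ^ 2) + 3 * Real.arccos (-ε)) > 0 := by
  have hA : 1 < Real.arccos (-ε) := by
    have h := Real.arcsin_nonneg.mpr h0.le
    rw [Real.arccos_eq_pi_div_two_sub_arcsin, Real.arcsin_neg]
    linarith [Real.pi_gt_three]
  have hq : 0 < 1 - ε ^ 2 := by nlinarith
  have hs0 : 0 < Real.sqrt (1 - ε ^ 2) := Real.sqrt_pos.mpr hq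
  have hs1 : Real.sqrt (1 - ε ^ 2) ≤ 1 := by
    rw [Real.sqrt_le_left (by norm_num)]
    nlinarith
  generalize Real.arccos (-ε) = A at *
  generalize Real.sqrt (1 - ε ^ 2) = s at *
  have hT : 0 < (1 - ε) ^ 2 * (-4 * ε ^ 2 - 12 * ε + 22)
      + (2 * ε - 1) * (1 + ε) * (5 - 4 * ε) * 3 := by
    nlinarith [mul_pos h0 (sub_pos.mpr h1), sq_nonneg (ε - 1 / 3), sq_nonneg (ε * (ε - 1 / 3)),
      mul_nonneg h0.le (sq_nonneg (ε - 1 / 3)), mul_nonneg (sub_pos.mpr h1).le (sq_nonneg (ε - 1 / 3)),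
      mul_nonneg (mul_pos h0 (sub_pos.mpr h1)).le (sq_nonneg (ε - 1 / 3))]
  have hST : 0 < ((1 - ε) ^ 2 * (-8 * ε ^ 3 - 8 * ε ^ 2 + 26 * ε - 4)
      + (2 * ε - 1) * (1 + ε) * (5 - 4 * ε) * (3 * ε)) +
      ((1 - ε) ^ 2 * (-4 * ε ^ 2 - 12 * ε + 22)
      + (2 * ε - 1) * (1 + ε) * (5 - 4 * ε) * 3) := by
    have hu := sub_pos.mpr h1
    have hp := mul_pos h0 hu
    nlinarith [hp, sq_nonneg (ε - 1 / 5), sq_nonneg (ε * (ε - 1 / 5)),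
      mul_nonneg h0.le (sq_nonneg (ε - 1 / 5)), mul_nonneg hu.le (sq_nonneg (ε - 1 / 5)),
      mul_nonneg hp.le (sq_nonneg (ε - 1 / 5)), mul_nonneg h0.le (sq_nonneg (ε * (ε - 1 / 5))),
      mul_nonneg hu.le (sq_nonneg (ε * (ε - 1 / 5)))]
  have e5 : 0 < 5 - 4 * ε := by linarith
  have e1 : 0 < 1 - ε := by linarith
  have hA0 : 0 < A := by linarith
  have key : ((1 - ε) / ((1 + ε) ^ 2 * A * (5 - 4 * ε))) *
        (s * (-8 * ε ^ 3 - 8 * ε ^ 2 + 26 * ε - 4) + A * (-4 * ε ^ 2 - 12 * ε + 22)) +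
      ((2 * ε - 1) / ((1 - ε ^ 2) * A)) * (3 * ε * s + 3 * A) =
      (s * (((1 - ε) ^ 2 * (-8 * ε ^ 3 - 8 * ε ^ 2 + 26 * ε - 4)
      + (2 * ε - 1) * (1 + ε) * (5 - 4 * ε) * (3 * ε)) +
      ((1 - ε) ^ 2 * (-4 * ε ^ 2 - 12 * ε + 22)
      + (2 * ε - 1) * (1 + ε) * (5 - 4 * ε) * 3)) + (A - s) * ((1 - ε) ^ 2 * (-4 * ε ^ 2 - 12 * ε + 22)
      + (2 * ε - 1) * (1 + ε) * (5 - 4 * ε) * 3)) / ((1 + ε) ^ 2 * A * (5 - 4 * ε) * (1 - ε)) := by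
    have e2 : 1 - ε ^ 2 = (1 - ε) * (1 + ε) := by ring
    have n1 : 1 + ε ≠ 0 := by positivity
    have n2 := e5.ne'
    have n3 := e1.ne'
    have n4 := hA0.ne'
    rw [e2]
    clear hT hST e5
    generalize 5 - 4 * ε = B at *
    field_simp
    ring
  rw [key]
  have hAs : 0 < A - s := by linarith
  exact div_pos (add_pos (mul_pos hs0 hST) (mul_pos hAs hT)) (by positivity)
end
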